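/- arXiv:1807.00688 — 9 statements merged into one kernel-verified Lean document; each statement's English description precedes it below -/
import Mathlib

section
/- Let u > 0, Γ > 0, n ≥ 2 an integer, h = 1/n, Pe = u·h/(2Γ), and Γ̄ = Γ·(Pe·coth(Pe) − 1). Define y(x) = (e^{u x / Γ} − 1)/(e^{u / Γ} − 1) and set c_j = y(j·h) for j = 0, …, n. Then for every j with 1 ≤ j ≤ n−1, the stabilized central-difference scheme is nodally exact: u·(c_{j+1} − c_{j−1})/(2h) − (Γ + Γ̄)·(c_{j+1} − 2c_j + c_{j−1})/h² = 0. -/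
/-- Three equally spaced samples of an exponential: the ratio of the first to the second central
difference is `coth` of the half step. -/
theorem sinh_mul_exp_first_difference (s p : ℝ) :
    Real.sinh p * (Real.exp (s + 2 * p) - Real.exp (s - 2 * p)) =
      Real.cosh p * (Real.exp (s + 2 * p) - 2 * Real.exp s + Real.exp (s - 2 * p)) := by
  have hsub : s - 2 * p = s + -p + -p := by ring
  have hadd : s + 2 * p = s + p + p := by ring
  rw [hsub, hadd, Real.sinh_eq, Real.cosh_eq]
  simp only [Real.exp_add, Real.exp_neg]
  field_simp
  ring

/-- With `u, Γ > 0`, `n ≥ 2`, `h = 1/n`, `Pe = u h / (2Γ)` and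
artificial diffusivity `Γ̄ = Γ * (Pe * coth Pe - 1)`, the nodal values
`c j = y (j h)` of the exact solution `y x = (exp (u x / Γ) - 1)/(exp (u/Γ) - 1)`
satisfy the stabilized central-difference scheme exactly at every interior node:
`u (c_{j+1} - c_{j-1})/(2h) - (Γ + Γ̄)(c_{j+1} - 2 c_j + c_{j-1})/h² = 0`. -/
theorem stabilized_scheme_nodally_exact
    (u Γ : ℝ) (hu : 0 < u) (hΓ : 0 < Γ)
    (n : ℕ) (hn : 2 ≤ n)
    (h Pe Γbar : ℝ)
    (hh : h = 1 / (n : ℝ))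
    (hPe : Pe = u * h / (2 * Γ))
    (hΓbar : Γbar = Γ * (Pe * (Real.cosh Pe / Real.sinh Pe) - 1))
    (y : ℝ → ℝ)
    (hy : ∀ x : ℝ, y x = (Real.exp (u * x / Γ) - 1) / (Real.exp (u / Γ) - 1))
    (c : ℕ → ℝ) (hc : ∀ j : ℕ, c j = y ((j : ℝ) * h)) :
    ∀ j : ℕ, 1 ≤ j → j ≤ n - 1 →
      u * (c (j + 1) - c (j - 1)) / (2 * h)
        - (Γ + Γbar) * (c (j + 1) - 2 * c j + c (j - 1)) / h ^ 2 = 0 := by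
  intro j hj _
  have hh_pos : 0 < h := by rw [hh]; positivity
  have hPe_pos : 0 < Pe := by rw [hPe]; positivity
  have hsinh : Real.sinh Pe ≠ 0 := (Real.sinh_pos_iff.2 hPe_pos).ne'
  obtain ⟨k, rfl⟩ := Nat.exists_eq_add_of_le' hj
  have hnext : u * (((k + 1 + 1 : ℕ) : ℝ) * h) / Γ =
      u * (((k + 1 : ℕ) : ℝ) * h) / Γ + 2 * Pe := by
    rw [hPe]; push_cast; field_simp
  have hprev : u * ((k : ℝ) * h) / Γ = u * (((k + 1 : ℕ) : ℝ) * h) / Γ - 2 * Pe := by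
    rw [hPe]; push_cast; field_simp; ring
  have hdiff : Real.sinh Pe * (c (k + 1 + 1) - c k) =
      Real.cosh Pe * (c (k + 1 + 1) - 2 * c (k + 1) + c k) := by
    simp only [hc, hy]
    rw [hnext, hprev]
    linear_combination (Real.exp (u / Γ) - 1)⁻¹ *
      sinh_mul_exp_first_difference (u * (((k + 1 : ℕ) : ℝ) * h) / Γ) Pe
  have hdiffusivity : Γ + Γbar = u * h / 2 * (Real.cosh Pe / Real.sinh Pe) := by
    have hΓPe : Γ * Pe = u * h / 2 := by rw [hPe]; field_simp
    rw [hΓbar, ← hΓPe]; ring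
  rw [Nat.add_sub_cancel, hdiffusivity]
  field_simp
  linear_combination u * hdiff
end

section
/- For every Pe > 0, Pe·coth(Pe) − 1 ≥ 5·Pe²/(Pe² + 15). Equivalently, the numerical diffusivity of the condensed cubic (p = 3) finite element scheme, Γ̄₃ = 5·Pe²·Γ/(Pe² + 15), never exceeds the nodally exact artificial diffusivity Γ̄ = Γ·(Pe·coth(Pe) − 1); the odd-degree scheme is under-diffusive at the nodes. -/
/-- A function on `ℝ` vanishing at `0` with nonnegative derivative on `[0, ∞)` is nonnegative
there. -/
theorem nonneg_of_hasDerivAt_nonneg {f f' : ℝ → ℝ} (h0 : f 0 = 0)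
    (hf : ∀ x, HasDerivAt f (f' x) x) (hf' : ∀ x, 0 ≤ x → 0 ≤ f' x) {x : ℝ} (hx : 0 ≤ x) :
    0 ≤ f x := by
  have hmono : MonotoneOn f (Set.Ici 0) := by
    refine monotoneOn_of_deriv_nonneg (convex_Ici 0)
      (fun y _ => (hf y).continuousAt.continuousWithinAt)
      (fun y _ => (hf y).differentiableAt.differentiableWithinAt) fun y hy => ?_
    rw [(hf y).deriv]
    exact hf' y (interior_subset hy)
  simpa [h0] using hmono Set.self_mem_Ici hx hx

theorem mul_cosh_sub_sinh_nonneg {x : ℝ} (hx : 0 ≤ x) : 0 ≤ x * Real.cosh x - Real.sinh x := by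
  refine nonneg_of_hasDerivAt_nonneg (f := fun x => x * Real.cosh x - Real.sinh x)
    (f' := fun x => x * Real.sinh x) (by simp) (fun y => ?_)
    (fun y hy => mul_nonneg hy (Real.sinh_nonneg_iff.2 hy)) hx
  refine HasDerivAt.congr_deriv (((hasDerivAt_id y).mul (Real.hasDerivAt_cosh y)).sub (Real.hasDerivAt_sinh y)) ?_
  simp

theorem sq_add_three_mul_sinh_sub_nonneg {x : ℝ} (hx : 0 ≤ x) :
    0 ≤ (x ^ 2 + 3) * Real.sinh x - 3 * x * Real.cosh x := by
  refine nonneg_of_hasDerivAt_nonneg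
    (f := fun x => (x ^ 2 + 3) * Real.sinh x - 3 * x * Real.cosh x)
    (f' := fun x => x * (x * Real.cosh x - Real.sinh x)) (by simp) (fun y => ?_)
    (fun y hy => mul_nonneg hy (mul_cosh_sub_sinh_nonneg hy)) hx
  refine HasDerivAt.congr_deriv ((((hasDerivAt_pow 2 y).add_const 3).mul (Real.hasDerivAt_sinh y)).sub
    (((hasDerivAt_id y).const_mul 3).mul (Real.hasDerivAt_cosh y))) ?_
  simp
  ring

theorem cubic_mul_cosh_sub_quadratic_mul_sinh_nonneg {x : ℝ} (hx : 0 ≤ x) :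
    0 ≤ (x ^ 3 + 15 * x) * Real.cosh x - (6 * x ^ 2 + 15) * Real.sinh x := by
  refine nonneg_of_hasDerivAt_nonneg
    (f := fun x => (x ^ 3 + 15 * x) * Real.cosh x - (6 * x ^ 2 + 15) * Real.sinh x)
    (f' := fun x => x * ((x ^ 2 + 3) * Real.sinh x - 3 * x * Real.cosh x)) (by simp)
    (fun y => ?_) (fun y hy => mul_nonneg hy (sq_add_three_mul_sinh_sub_nonneg hy)) hx
  refine HasDerivAt.congr_deriv ((((hasDerivAt_pow 3 y).add ((hasDerivAt_id y).const_mul 15)).mul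
    (Real.hasDerivAt_cosh y)).sub
    ((((hasDerivAt_pow 2 y).const_mul 6).add_const 15).mul (Real.hasDerivAt_sinh y))) ?_
  simp
  ring

/-- For every `Pe > 0`, `Pe * coth Pe - 1 ≥ 5 Pe² / (Pe² + 15)`;
equivalently, the numerical diffusivity `Γ̄₃ = 5 Pe² Γ / (Pe² + 15)` of the
condensed cubic (p = 3) finite element scheme never exceeds the nodally exact
artificial diffusivity `Γ̄ = Γ (Pe coth Pe - 1)`: the odd-degree scheme is
under-diffusive at the nodes. -/
theorem p3_scheme_under_diffusive :
    ∀ Pe : ℝ, 0 < Pe →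
      5 * Pe ^ 2 / (Pe ^ 2 + 15) ≤ Pe * (Real.cosh Pe / Real.sinh Pe) - 1 ∧
      ∀ Γ : ℝ, 0 < Γ →
        5 * Pe ^ 2 * Γ / (Pe ^ 2 + 15) ≤
          Γ * (Pe * (Real.cosh Pe / Real.sinh Pe) - 1) := by
  intro Pe hPe
  have key : 5 * Pe ^ 2 / (Pe ^ 2 + 15) ≤ Pe * (Real.cosh Pe / Real.sinh Pe) - 1 := by
    have hs : 0 < Real.sinh Pe := Real.sinh_pos_iff.2 hPe
    have h := cubic_mul_cosh_sub_quadratic_mul_sinh_nonneg hPe.le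
    have heq : Pe * (Real.cosh Pe / Real.sinh Pe) - 1
        = (Pe * Real.cosh Pe - Real.sinh Pe) / Real.sinh Pe := by
      field_simp
    rw [heq, div_le_div_iff₀ (by positivity) hs]
    linarith
  refine ⟨key, fun Γ hΓ => ?_⟩
  calc 5 * Pe ^ 2 * Γ / (Pe ^ 2 + 15) = Γ * (5 * Pe ^ 2 / (Pe ^ 2 + 15)) := by ring
    _ ≤ Γ * (Pe * (Real.cosh Pe / Real.sinh Pe) - 1) := mul_le_mul_of_nonneg_left key hΓ.le
end

section
/- For every Pe > 0, Pe·coth(Pe) − 1 ≤ (Pe⁴ + 35·Pe²)/(10·Pe² + 105). Equivalently, the numerical diffusivity of the condensed quartic (p = 4) finite element scheme, Γ̄₄ = Γ·(Pe⁴ + 35·Pe²)/(10·Pe² + 105), is always at least as large as the nodally exact artificial diffusivity Γ̄ = Γ·(Pe·coth(Pe) − 1). -/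
/-- A function vanishing at `0` whose derivative is `x * g x` with `g` nonnegative on `[0, ∞)` is
nonnegative on `[0, ∞)`. -/
lemma nonneg_of_hasDerivAt_mul {f g : ℝ → ℝ} (hf : ∀ x, HasDerivAt f (x * g x) x)
    (h0 : f 0 = 0) (hg : ∀ x, 0 ≤ x → 0 ≤ g x) (x : ℝ) (hx : 0 ≤ x) : 0 ≤ f x := by
  have hmono : MonotoneOn f (Set.Ici 0) := by
    refine monotoneOn_of_hasDerivWithinAt_nonneg (convex_Ici 0)
      (fun y _ => (hf y).continuousAt.continuousWithinAt)
      (fun y _ => (hf y).hasDerivWithinAt) fun y hy => ?_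
    rw [interior_Ici] at hy
    exact mul_nonneg hy.le (hg y hy.le)
  exact h0 ▸ hmono Set.self_mem_Ici hx hx

lemma hasDerivAt_mul_sinh_sub_mul_cosh {a b : ℝ → ℝ} {a' b' x : ℝ} (ha : HasDerivAt a a' x)
    (hb : HasDerivAt b b' x) :
    HasDerivAt (fun y => a y * Real.sinh y - b y * Real.cosh y)
      ((a' - b x) * Real.sinh x + (a x - b') * Real.cosh x) x :=
  ((ha.mul (Real.hasDerivAt_sinh x)).sub (hb.mul (Real.hasDerivAt_cosh x))).congr_deriv (by ring)

lemma sinh_le_mul_cosh (x : ℝ) (hx : 0 ≤ x) : 0 ≤ x * Real.cosh x - Real.sinh x := by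
  refine nonneg_of_hasDerivAt_mul (f := fun y => y * Real.cosh y - Real.sinh y)
    (g := Real.sinh) (fun y => ?_) (by simp) (fun y hy => Real.sinh_nonneg_iff.2 hy) x hx
  exact (((hasDerivAt_id' y).mul (Real.hasDerivAt_cosh y)).sub
    (Real.hasDerivAt_sinh y)).congr_deriv (by ring)

lemma three_mul_cosh_le (x : ℝ) (hx : 0 ≤ x) :
    0 ≤ (x ^ 2 + 3) * Real.sinh x - (3 * x) * Real.cosh x := by
  refine nonneg_of_hasDerivAt_mul
    (f := fun y => (y ^ 2 + 3) * Real.sinh y - (3 * y) * Real.cosh y)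
    (fun y => ?_) (by simp) sinh_le_mul_cosh x hx
  have ha : HasDerivAt (fun y : ℝ => y ^ 2 + 3) (2 * y) y :=
    ((hasDerivAt_pow 2 y).add_const 3).congr_deriv (by norm_num)
  have hb : HasDerivAt (fun y : ℝ => 3 * y) 3 y :=
    ((hasDerivAt_id' y).const_mul 3).congr_deriv (by norm_num)
  exact (hasDerivAt_mul_sinh_sub_mul_cosh ha hb).congr_deriv (by ring)

lemma sinh_le_cubic_mul_cosh (x : ℝ) (hx : 0 ≤ x) :
    0 ≤ (-(6 * x ^ 2 + 15)) * Real.sinh x - (-(x ^ 3 + 15 * x)) * Real.cosh x := by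
  refine nonneg_of_hasDerivAt_mul
    (f := fun y => (-(6 * y ^ 2 + 15)) * Real.sinh y - (-(y ^ 3 + 15 * y)) * Real.cosh y)
    (fun y => ?_) (by simp) three_mul_cosh_le x hx
  have ha : HasDerivAt (fun y : ℝ => -(6 * y ^ 2 + 15)) (-(12 * y)) y :=
    ((((hasDerivAt_pow 2 y).const_mul 6).add_const 15).neg).congr_deriv
      (by norm_num; ring)
  have hb : HasDerivAt (fun y : ℝ => -(y ^ 3 + 15 * y)) (-(3 * y ^ 2 + 15)) y :=
    (((hasDerivAt_pow 3 y).add ((hasDerivAt_id' y).const_mul 15)).neg).congr_deriv (by norm_num)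
  exact (hasDerivAt_mul_sinh_sub_mul_cosh ha hb).congr_deriv (by ring)

lemma cubic_mul_cosh_le_quartic_mul_sinh (x : ℝ) (hx : 0 ≤ x) :
    0 ≤ (x ^ 4 + 45 * x ^ 2 + 105) * Real.sinh x - (10 * x ^ 3 + 105 * x) * Real.cosh x := by
  refine nonneg_of_hasDerivAt_mul
    (f := fun y => (y ^ 4 + 45 * y ^ 2 + 105) * Real.sinh y - (10 * y ^ 3 + 105 * y) * Real.cosh y)
    (fun y => ?_) (by simp) sinh_le_cubic_mul_cosh x hx
  have ha : HasDerivAt (fun y : ℝ => y ^ 4 + 45 * y ^ 2 + 105) (4 * y ^ 3 + 90 * y) y :=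
    (((hasDerivAt_pow 4 y).add ((hasDerivAt_pow 2 y).const_mul 45)).add_const 105).congr_deriv
      (by norm_num; ring)
  have hb : HasDerivAt (fun y : ℝ => 10 * y ^ 3 + 105 * y) (30 * y ^ 2 + 105) y :=
    (((hasDerivAt_pow 3 y).const_mul 10).add ((hasDerivAt_id' y).const_mul 105)).congr_deriv
      (by norm_num; ring)
  exact (hasDerivAt_mul_sinh_sub_mul_cosh ha hb).congr_deriv (by ring)

/-- For every `Pe > 0`,
`Pe * coth Pe - 1 ≤ (Pe⁴ + 35 Pe²) / (10 Pe² + 105)`; equivalently, the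
numerical diffusivity `Γ̄₄ = Γ (Pe⁴ + 35 Pe²) / (10 Pe² + 105)` of the condensed
quartic (p = 4) finite element scheme is always at least as large as the
nodally exact artificial diffusivity `Γ̄ = Γ (Pe coth Pe - 1)`. -/
theorem p4_scheme_over_diffusive :
    ∀ Pe : ℝ, 0 < Pe →
      Pe * (Real.cosh Pe / Real.sinh Pe) - 1 ≤
        (Pe ^ 4 + 35 * Pe ^ 2) / (10 * Pe ^ 2 + 105) ∧
      ∀ Γ : ℝ, 0 < Γ →
        Γ * (Pe * (Real.cosh Pe / Real.sinh Pe) - 1) ≤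
          Γ * (Pe ^ 4 + 35 * Pe ^ 2) / (10 * Pe ^ 2 + 105) := by
  intro Pe hPe
  have hs : 0 < Real.sinh Pe := Real.sinh_pos_iff.2 hPe
  have main : Pe * (Real.cosh Pe / Real.sinh Pe) - 1 ≤
      (Pe ^ 4 + 35 * Pe ^ 2) / (10 * Pe ^ 2 + 105) := by
    have h := cubic_mul_cosh_le_quartic_mul_sinh Pe hPe.le
    rw [← mul_div_assoc, div_sub_one hs.ne', div_le_div_iff₀ hs (by positivity)]
    linarith
  refine ⟨main, fun Γ hΓ => ?_⟩
  rw [mul_div_assoc]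
  exact mul_le_mul_of_nonneg_left main hΓ.le
end

section
/- For every Pe > 0, the condensed-scheme parameter of the quadratic p-FEM, α₂(Pe) = Pe/(1 + Pe²/3), satisfies α₂(Pe) ≤ √3/2 < 1, with equality α₂(Pe) = √3/2 if and only if Pe = √3. In particular the nodal solution of the p = 2 scheme never oscillates, for every mesh Péclet number. -/
theorem sqrt_three_div_two_sub (x : ℝ) :
    √3 / 2 - x / (1 + x ^ 2 / 3) = √3 / 6 / (1 + x ^ 2 / 3) * (x - √3) ^ 2 := by
  have h3 : √3 ^ 2 = (3 : ℝ) := Real.sq_sqrt (by norm_num)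
  have hx : 1 + x ^ 2 / 3 ≠ 0 := by positivity
  rw [div_mul_eq_mul_div, eq_div_iff hx, sub_mul, div_mul_cancel₀ _ hx]
  linear_combination (x / 3 - √3 / 6) * h3

/-- For every `Pe > 0`, the condensed-scheme parameter of the
quadratic p-FEM, `α₂(Pe) = Pe / (1 + Pe²/3)`, satisfies
`α₂(Pe) ≤ √3/2 < 1`, with equality `α₂(Pe) = √3/2` iff `Pe = √3`. In
particular the nodal solution of the `p = 2` scheme never oscillates. -/
theorem alpha2_le_sqrt3_div_two :
    (∀ Pe : ℝ, 0 < Pe →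
      Pe / (1 + Pe ^ 2 / 3) ≤ Real.sqrt 3 / 2 ∧
      (Pe / (1 + Pe ^ 2 / 3) = Real.sqrt 3 / 2 ↔ Pe = Real.sqrt 3)) ∧
    Real.sqrt 3 / 2 < 1 := by
  refine ⟨fun x _ => ?_, ?_⟩
  · have key := sqrt_three_div_two_sub x
    have hc : 0 < √3 / 6 / (1 + x ^ 2 / 3) := by positivity
    refine ⟨sub_nonneg.mp (key ▸ by positivity), ?_⟩
    rw [eq_comm, ← sub_eq_zero, key, mul_eq_zero, or_iff_right hc.ne', sq_eq_zero_iff,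
      sub_eq_zero]
  · rw [div_lt_one two_pos, Real.sqrt_lt' two_pos]
    norm_num
end

section
/- For every Pe > 0, the condensed-scheme parameter of the quartic p-FEM satisfies α₄(Pe) = Pe·(10·Pe² + 105)/(Pe⁴ + 45·Pe² + 105) < 1; equivalently, Pe⁴ + 45·Pe² + 105 − 10·Pe³ − 105·Pe > 0 for all Pe > 0. In particular the nodal solution of the p = 4 scheme never oscillates, for every mesh Péclet number. -/
/-- For every `Pe > 0`, the condensed-scheme parameter of the
quartic p-FEM satisfies
`α₄(Pe) = Pe (10 Pe² + 105) / (Pe⁴ + 45 Pe² + 105) < 1`; equivalently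
`Pe⁴ + 45 Pe² + 105 - 10 Pe³ - 105 Pe > 0`. In particular the nodal solution
of the `p = 4` scheme never oscillates, for every mesh Péclet number. -/
theorem alpha4_lt_one :
    ∀ Pe : ℝ, 0 < Pe →
      Pe * (10 * Pe ^ 2 + 105) / (Pe ^ 4 + 45 * Pe ^ 2 + 105) < 1 ∧
      0 < Pe ^ 4 + 45 * Pe ^ 2 + 105 - 10 * Pe ^ 3 - 105 * Pe := by
  intro Pe hPe
  have hpos : 0 < Pe ^ 4 + 45 * Pe ^ 2 + 105 - 10 * Pe ^ 3 - 105 * Pe := by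
    linarith [sq_nonneg (Pe ^ 2 - 5 * Pe + 8), sq_nonneg (8 * Pe - 25)]
  refine ⟨?_, hpos⟩
  rw [div_lt_one (by positivity)]
  linarith
end

section
/- The cubic polynomial g(Pe) = Pe³ − 6·Pe² + 15·Pe − 15 is strictly increasing on ℝ and has a unique real root Pe₃*, which lies in the interval (2.3221, 2.3222). Moreover, for Pe > 0, the condensed-scheme parameter of the cubic p-FEM, α₃(Pe) = Pe·(Pe² + 15)/(6·Pe² + 15), satisfies α₃(Pe) < 1 if and only if Pe < Pe₃*; i.e., Pe₃* ≈ 2.322185 is the maximal mesh Péclet number guaranteeing nodally stable solutions for polynomial degree 3. -/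
theorem strictMono_cubic_sub_six_sq :
    StrictMono (fun x : ℝ => x ^ 3 - 6 * x ^ 2 + 15 * x - 15) := by
  intro a b hab
  have h : 0 < (b - a) * ((b - 2) ^ 2 + (b - 2) * (a - 2) + (a - 2) ^ 2 + 3) :=
    mul_pos (sub_pos.2 hab) (by nlinarith [sq_nonneg (a + b - 4), sq_nonneg (a - b)])
  dsimp only
  linear_combination h

/-- The cubic `g(Pe) = Pe³ - 6 Pe² + 15 Pe - 15` is strictly
increasing on `ℝ` and has a unique real root `Pe₃*`, lying in
`(2.3221, 2.3222)`; moreover, for `Pe > 0` the condensed-scheme parameter of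
the cubic p-FEM, `α₃(Pe) = Pe (Pe² + 15) / (6 Pe² + 15)`, satisfies
`α₃(Pe) < 1` iff `Pe < Pe₃*`: `Pe₃* ≈ 2.322185` is the maximal mesh Péclet
number guaranteeing nodally stable solutions for polynomial degree 3. -/
theorem cubic_pfem_stability_threshold :
    StrictMono (fun Pe : ℝ => Pe ^ 3 - 6 * Pe ^ 2 + 15 * Pe - 15) ∧
    ∃ Pe₃ : ℝ,
      (∀ Pe : ℝ, Pe ^ 3 - 6 * Pe ^ 2 + 15 * Pe - 15 = 0 ↔ Pe = Pe₃) ∧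
      Pe₃ ∈ Set.Ioo (2.3221 : ℝ) 2.3222 ∧
      ∀ Pe : ℝ, 0 < Pe →
        (Pe * (Pe ^ 2 + 15) / (6 * Pe ^ 2 + 15) < 1 ↔ Pe < Pe₃) := by
  have hmono := strictMono_cubic_sub_six_sq
  refine ⟨hmono, ?_⟩
  obtain ⟨r, hr, hroot⟩ : ∃ r ∈ Set.Ioo (2.3221 : ℝ) 2.3222,
      r ^ 3 - 6 * r ^ 2 + 15 * r - 15 = 0 :=
    intermediate_value_Ioo (f := fun x : ℝ => x ^ 3 - 6 * x ^ 2 + 15 * x - 15)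
      (by norm_num) (by fun_prop) (by constructor <;> norm_num)
  refine ⟨r, fun x => ⟨fun hx => hmono.injective (hx.trans hroot.symm), ?_⟩, hr,
    fun x _ => ?_⟩
  · rintro rfl
    exact hroot
  · rw [div_lt_one (by positivity), ← hmono.lt_iff_lt (a := x), hroot]
    constructor <;> intro h <;> linarith
end

section
/- The quintic polynomial h(Pe) = Pe⁵ − 15·Pe⁴ + 105·Pe³ − 420·Pe² + 945·Pe − 945 has exactly one real root Pe₅*, which lies in the interval (3.646, 3.647). Moreover, for Pe > 0, the condensed-scheme parameter of the quintic p-FEM, α₅(Pe) = Pe·(Pe⁴ + 105·Pe² + 945)/(15·Pe⁴ + 420·Pe² + 945), satisfies α₅(Pe) < 1 if and only if Pe < Pe₅*; i.e., Pe₅* ≈ 3.646738 is the maximal mesh Péclet number guaranteeing nodally stable solutions for polynomial degree 5. -/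
/-- This quintic polynomial is strictly increasing on the real line: its derivative
is `5 * ((x ^ 2 - 6 * x + 11) ^ 2 + 5 * (x - 18 / 5) ^ 2 + 16 / 5)`. -/
theorem strictMono_quintic : StrictMono fun x : ℝ =>
    x ^ 5 - 15 * x ^ 4 + 105 * x ^ 3 - 420 * x ^ 2 + 945 * x - 945 := by
  refine strictMono_of_hasDerivAt_pos
    (f' := fun x => 5 * ((x ^ 2 - 6 * x + 11) ^ 2 + 5 * (x - 18 / 5) ^ 2 + 16 / 5))
    (fun x => ?_) (fun x => by positivity)
  refine HasDerivAt.congr_deriv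
    ((((((hasDerivAt_pow 5 x).sub ((hasDerivAt_pow 4 x).const_mul 15)).add
    ((hasDerivAt_pow 3 x).const_mul 105)).sub ((hasDerivAt_pow 2 x).const_mul 420)).add
    ((hasDerivAt_id x).const_mul 945)).sub_const 945) ?_
  norm_num
  ring

/-- The quintic
`h(Pe) = Pe⁵ - 15 Pe⁴ + 105 Pe³ - 420 Pe² + 945 Pe - 945` has exactly one real
root `Pe₅*`, lying in `(3.646, 3.647)`; moreover, for `Pe > 0` the
condensed-scheme parameter of the quintic p-FEM,
`α₅(Pe) = Pe (Pe⁴ + 105 Pe² + 945) / (15 Pe⁴ + 420 Pe² + 945)`, satisfies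
`α₅(Pe) < 1` iff `Pe < Pe₅*`: `Pe₅* ≈ 3.646738` is the maximal mesh Péclet
number guaranteeing nodally stable solutions for polynomial degree 5. -/
theorem quintic_pfem_stability_threshold :
    ∃ Pe₅ : ℝ,
      (∀ Pe : ℝ,
        Pe ^ 5 - 15 * Pe ^ 4 + 105 * Pe ^ 3 - 420 * Pe ^ 2 + 945 * Pe - 945 = 0
          ↔ Pe = Pe₅) ∧
      Pe₅ ∈ Set.Ioo (3.646 : ℝ) 3.647 ∧
      ∀ Pe : ℝ, 0 < Pe →
        (Pe * (Pe ^ 4 + 105 * Pe ^ 2 + 945) /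
            (15 * Pe ^ 4 + 420 * Pe ^ 2 + 945) < 1 ↔ Pe < Pe₅) := by
  obtain ⟨r, hr, hr0⟩ := intermediate_value_Ioo (a := (3.646 : ℝ)) (b := 3.647) (by norm_num)
    (f := fun x : ℝ => x ^ 5 - 15 * x ^ 4 + 105 * x ^ 3 - 420 * x ^ 2 + 945 * x - 945)
    (by fun_prop) (show (0 : ℝ) ∈ Set.Ioo _ _ by constructor <;> norm_num)
  beta_reduce at hr0
  refine ⟨r, fun x => ?_, hr, fun x hx => ?_⟩
  · rw [← strictMono_quintic.injective.eq_iff (a := x), hr0]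
  · rw [div_lt_one (by positivity), ← strictMono_quintic.lt_iff_lt (a := x), hr0]
    constructor <;> intro h <;> linarith
end

section
/- Let α > 1, n ≥ 2, r = (1+α)/(1−α), and c_j = (r^j − 1)/(r^n − 1) for j = 0,…,n. Then r < −1 and the consecutive differences c_{j+1} − c_j alternate in sign as j runs from 0 to n−1; i.e., for mesh Péclet number exceeding 1 the standard linear Bubnov–Galerkin (central) discretization produces a non-physically oscillating nodal solution. -/
/-- For `α > 1`, `n ≥ 2`, `r = (1+α)/(1-α)` and
`c_j = (r^j - 1)/(r^n - 1)`, we have `r < -1` and consecutive differences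
`c_{j+1} - c_j` alternate in sign as `j` runs from `0` to `n-1`: for mesh
Péclet number exceeding `1` the standard linear Bubnov–Galerkin (central)
discretization produces a non-physically oscillating nodal solution. -/
theorem discrete_solution_oscillates_of_alpha_gt_one
    (α : ℝ) (hα : 1 < α) (n : ℕ) (hn : 2 ≤ n)
    (r : ℝ) (hr : r = (1 + α) / (1 - α))
    (c : ℕ → ℝ) (hc : ∀ j : ℕ, c j = (r ^ j - 1) / (r ^ n - 1)) :
    r < -1 ∧ ∀ j : ℕ, j + 2 ≤ n →
      (c (j + 1) - c j) * (c (j + 2) - c (j + 1)) < 0 := by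
  have hr1 : r < -1 := by
    rw [hr, div_lt_iff_of_neg (by linarith)]
    linarith
  refine ⟨hr1, fun j _ => ?_⟩
  have hD : r ^ n - 1 ≠ 0 := by
    intro h
    have habs : 1 < |r| ^ n := one_lt_pow₀ (lt_abs.2 (Or.inr (by linarith))) (by omega)
    rw [← abs_pow, sub_eq_zero.1 h, abs_one] at habs
    exact lt_irrefl _ habs
  have hprod : (c (j + 1) - c j) * (c (j + 2) - c (j + 1)) =
      r * (r ^ j * (r - 1) / (r ^ n - 1)) ^ 2 := by
    rw [hc, hc, hc]
    ring
  have hr0 : r ≠ 0 := (by linarith : r < 0).ne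
  have hr2 : r - 1 ≠ 0 := (by linarith : r - 1 < 0).ne
  rw [hprod]
  exact mul_neg_of_neg_of_pos (by linarith) (by positivity)
end

section
/- As Pe → ∞, the ratio (Pe·coth(Pe) − 1)/Pe tends to 1 (so the nodally exact artificial diffusivity Γ̄ = Γ·(Pe·coth(Pe) − 1) grows without bound, asymptotically like Γ·Pe), whereas the odd-degree p-FEM diffusivity ratios remain bounded: 5·Pe²/(Pe² + 15) → 5 and 14·(4·Pe⁴ + 90·Pe²)/(4·Pe⁴ + 420·Pe² + 3780) → 14 as Pe → ∞. Hence for odd polynomial degrees the numerical diffusivity falls arbitrarily far short of the nodally exact value at large mesh Péclet numbers, which explains the oscillatory behaviour of odd-degree schemes at high Pe. -/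
open Filter

/-- The hyperbolic cotangent tends to `1` at infinity. -/
theorem tendsto_cosh_div_sinh_atTop :
    Tendsto (fun x : ℝ => Real.cosh x / Real.sinh x) atTop (nhds 1) := by
  have hexp : Tendsto (fun x : ℝ => Real.exp (-x)) atTop (nhds 0) :=
    Real.tendsto_exp_neg_atTop_nhds_zero
  have hlim : Tendsto (fun x : ℝ => (1 + Real.exp (-x) ^ 2) / (1 - Real.exp (-x) ^ 2))
      atTop (nhds ((1 + 0 ^ 2) / (1 - 0 ^ 2))) :=
    ((hexp.pow 2).const_add 1).div ((hexp.pow 2).const_sub 1) (by norm_num)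
  norm_num only at hlim
  refine hlim.congr fun x => ?_
  have hmul : Real.exp x * Real.exp (-x) = 1 := by
    rw [← Real.exp_add, add_neg_cancel, Real.exp_zero]
  rw [Real.cosh_eq, Real.sinh_eq, div_div_div_cancel_right₀ two_ne_zero,
    ← mul_div_mul_right (Real.exp x + Real.exp (-x)) _ (Real.exp_pos (-x)).ne',
    add_mul, sub_mul, hmul, ← sq]

/-- As `Pe → ∞`, `(Pe coth Pe - 1)/Pe → 1` (so for every `Γ > 0`
the nodally exact artificial diffusivity `Γ̄ = Γ (Pe coth Pe - 1)` grows
without bound), whereas the odd-degree p-FEM diffusivity ratios stay bounded: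
`5 Pe²/(Pe² + 15) → 5` and
`14 (4 Pe⁴ + 90 Pe²)/(4 Pe⁴ + 420 Pe² + 3780) → 14`. -/
theorem odd_degree_diffusivity_bounded_exact_unbounded :
    Tendsto (fun Pe : ℝ =>
        (Pe * (Real.cosh Pe / Real.sinh Pe) - 1) / Pe) atTop (nhds 1) ∧
    (∀ Γ : ℝ, 0 < Γ →
      Tendsto (fun Pe : ℝ =>
        Γ * (Pe * (Real.cosh Pe / Real.sinh Pe) - 1)) atTop atTop) ∧
    Tendsto (fun Pe : ℝ => 5 * Pe ^ 2 / (Pe ^ 2 + 15)) atTop (nhds 5) ∧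
    Tendsto (fun Pe : ℝ =>
        14 * (4 * Pe ^ 4 + 90 * Pe ^ 2) /
          (4 * Pe ^ 4 + 420 * Pe ^ 2 + 3780)) atTop (nhds 14) := by
  have hinv : Tendsto (fun x : ℝ => x⁻¹) atTop (nhds 0) := tendsto_inv_atTop_zero
  have hexact : Tendsto (fun Pe : ℝ =>
      (Pe * (Real.cosh Pe / Real.sinh Pe) - 1) / Pe) atTop (nhds 1) := by
    have hlim := tendsto_cosh_div_sinh_atTop.sub hinv
    rw [sub_zero] at hlim
    refine hlim.congr' ?_
    filter_upwards [eventually_ne_atTop 0] with x hx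
    rw [sub_div, mul_div_cancel_left₀ _ hx, one_div]
  refine ⟨hexact, fun Γ hΓ => ?_, ?_, ?_⟩
  · refine Tendsto.const_mul_atTop hΓ ?_
    refine (hexact.pos_mul_atTop one_pos tendsto_id).congr' ?_
    filter_upwards [eventually_ne_atTop 0] with x hx
    exact div_mul_cancel₀ _ hx
  · have hlim : Tendsto (fun x : ℝ => 5 / (1 + 15 * x⁻¹ ^ 2)) atTop
        (nhds (5 / (1 + 15 * 0 ^ 2))) :=
      tendsto_const_nhds.div (((hinv.pow 2).const_mul 15).const_add 1) (by norm_num)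
    norm_num only at hlim
    refine hlim.congr' ?_
    filter_upwards [eventually_ne_atTop 0] with x hx
    field_simp
  · have hlim : Tendsto (fun x : ℝ => 14 * (4 + 90 * x⁻¹ ^ 2) /
        (4 + 420 * x⁻¹ ^ 2 + 3780 * x⁻¹ ^ 4)) atTop
        (nhds (14 * (4 + 90 * 0 ^ 2) / (4 + 420 * 0 ^ 2 + 3780 * 0 ^ 4))) :=
      ((((hinv.pow 2).const_mul 90).const_add 4).const_mul 14).div
        ((((hinv.pow 2).const_mul 420).const_add 4).add ((hinv.pow 4).const_mul 3780))
        (by norm_num)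
    norm_num only at hlim
    refine hlim.congr' ?_
    filter_upwards [eventually_ne_atTop 0] with x hx
    field_simp
end
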